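/- arXiv:1612.02466 — 2 statements merged into one kernel-verified Lean document; each statement's English description precedes it below -/
import Mathlib

section
/- Consider a scaling n ↦ (K_{1,n},...,K_{r,n},P_n) with 2 ≤ K_{1,n} ≤ ... ≤ K_{r,n} ≤ P_n/2, a fixed probability vector (μ_1,...,μ_r) with all μ_i > 0, and let K_avg,n = Σ_{j=1}^r μ_j K_{j,n} be the mean key ring size. If K_{1,n}·K_avg,n/P_n = o(1), then λ_1(n) ~ K_{1,n}·K_avg,n/P_n as n → ∞, where λ_1(n) = Σ_{j=1}^r μ_j·(1 − C(P_n−K_{1,n}, K_{j,n})/C(P_n, K_{j,n})). -/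
open Filter
open scoped BigOperators Topology

/-- One-step recurrence for the probability `C(P-a, b) / C(P, b)` of missing a `b`-subset. -/
lemma choose_div_choose_succ {P a b : ℕ} (h : a + 1 + b ≤ P) :
    ((P - (a + 1)).choose b : ℝ) / (P.choose b : ℝ) =
      ((P - a).choose b : ℝ) / (P.choose b : ℝ) * (1 - (b : ℝ) / ((P : ℝ) - a)) := by
  obtain ⟨c, rfl⟩ := Nat.exists_eq_add_of_le h
  have e1 : a + 1 + b + c - (a + 1) = b + c := by omega
  have e2 : a + 1 + b + c - a = b + c + 1 := by omega
  rw [e1, e2]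
  have hrec := Nat.choose_mul_succ_eq (b + c) b
  have e3 : b + c + 1 - b = c + 1 := by omega
  rw [e3] at hrec
  have hrec' : ((b + c).choose b : ℝ) * ((b : ℝ) + c + 1) =
      ((b + c + 1).choose b : ℝ) * ((c : ℝ) + 1) := by exact_mod_cast hrec
  have e4 : ((a + 1 + b + c : ℕ) : ℝ) - a = (b : ℝ) + c + 1 := by push_cast; ring
  have hpos : (0 : ℝ) < (b : ℝ) + c + 1 := by positivity
  have e5 : 1 - (b : ℝ) / ((b : ℝ) + c + 1) = ((c : ℝ) + 1) / ((b : ℝ) + c + 1) := by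
    field_simp; ring
  rw [e4, e5, div_mul_div_comm, ← hrec', mul_div_mul_right _ _ hpos.ne']

lemma choose_sub_div_choose_le_one (P a b : ℕ) :
    ((P - a).choose b : ℝ) / (P.choose b : ℝ) ≤ 1 :=
  div_le_one_of_le₀ (by exact_mod_cast Nat.choose_le_choose b (Nat.sub_le P a))
    (Nat.cast_nonneg _)

/-- Union bound on the intersection probability. -/
lemma one_sub_choose_div_choose_le {P a b : ℕ} (h : a + b ≤ P) (ha : a < P) :
    1 - ((P - a).choose b : ℝ) / (P.choose b : ℝ) ≤ (a : ℝ) * b / ((P : ℝ) - a) := by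
  induction a with
  | zero =>
    have hb : (P.choose b : ℝ) ≠ 0 := by
      exact_mod_cast (Nat.choose_pos (by omega : b ≤ P)).ne'
    simp [hb]
  | succ a ih =>
    have ih' := ih (by omega) (by omega)
    rw [choose_div_choose_succ h]
    have hq := choose_sub_div_choose_le_one P a b
    have haP : ((a : ℝ) + 1) < P := by exact_mod_cast ha
    have hy : 0 ≤ (b : ℝ) / ((P : ℝ) - a) := div_nonneg (Nat.cast_nonneg _) (by linarith)
    have hmono : ((a : ℝ) + 1) * b / ((P : ℝ) - a) ≤
        ((a : ℝ) + 1) * b / ((P : ℝ) - ((a : ℝ) + 1)) := by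
      apply div_le_div_of_nonneg_left (by positivity) (by linarith) (by linarith)
    have hsplit : ((a : ℝ) + 1) * b / ((P : ℝ) - a) =
        (a : ℝ) * b / ((P : ℝ) - a) + (b : ℝ) / ((P : ℝ) - a) := by ring
    push_cast
    nlinarith [mul_le_mul_of_nonneg_right hq hy]

/-- Bernoulli-type bound on the probability of missing a `b`-subset. -/
lemma choose_div_choose_mul_le_one {P a b : ℕ} (h : a + b ≤ P) :
    ((P - a).choose b : ℝ) / (P.choose b : ℝ) * (1 + (a : ℝ) * ((b : ℝ) / P)) ≤ 1 := by
  induction a with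
  | zero => simpa using div_self_le_one (P.choose b : ℝ)
  | succ a ih =>
    have ih' := ih (by omega)
    rw [choose_div_choose_succ h]
    have hq : 0 ≤ ((P - a).choose b : ℝ) / (P.choose b : ℝ) := by positivity
    set q := ((P - a).choose b : ℝ) / (P.choose b : ℝ)
    have haP : (a : ℝ) + 1 + b ≤ P := by exact_mod_cast h
    have hb : (0 : ℝ) ≤ b := Nat.cast_nonneg b
    have ha : (0 : ℝ) ≤ a := Nat.cast_nonneg a
    have hy : 0 ≤ (b : ℝ) / P := by positivity
    have hle : (b : ℝ) / P ≤ (b : ℝ) / ((P : ℝ) - a) :=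
      div_le_div_of_nonneg_left hb (by linarith) (by linarith)
    set y := (b : ℝ) / P
    push_cast
    calc q * (1 - (b : ℝ) / ((P : ℝ) - a)) * (1 + ((a : ℝ) + 1) * y)
        ≤ q * (1 - y) * (1 + ((a : ℝ) + 1) * y) := by gcongr
      _ = q * (1 + a * y) - q * ((a + 1) * y ^ 2) := by ring
      _ ≤ q * (1 + a * y) := sub_le_self _ (by positivity)
      _ ≤ 1 := ih'

/-- Two-sided first-order estimate of the intersection probability. -/
lemma one_sub_choose_div_choose_bounds {P a b : ℕ} (ha : 2 * a ≤ P) (hb : 2 * b ≤ P)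
    (hP : 0 < P) :
    (a : ℝ) * b / P * (1 - (a : ℝ) * b / P) ≤
        1 - ((P - a).choose b : ℝ) / (P.choose b : ℝ) ∧
      1 - ((P - a).choose b : ℝ) / (P.choose b : ℝ) ≤
        (a : ℝ) * b / P * (1 + 2 * ((a : ℝ) / P)) := by
  have hPr : (0 : ℝ) < P := by exact_mod_cast hP
  have ha' : 2 * (a : ℝ) ≤ P := by exact_mod_cast ha
  constructor
  · have hq := choose_div_choose_mul_le_one (P := P) (a := a) (b := b) (by omega)
    rw [← mul_div_assoc] at hq
    have hx : 0 ≤ (a : ℝ) * b / P := by positivity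
    set x := (a : ℝ) * b / P
    set q := ((P - a).choose b : ℝ) / (P.choose b : ℝ)
    have hq' : q ≤ 1 / (1 + x) := by rwa [le_div_iff₀ (by linarith)]
    have hx' : 1 / (1 + x) ≤ 1 - x * (1 - x) := by
      rw [div_le_iff₀ (by linarith)]
      nlinarith [pow_nonneg hx 3]
    linarith
  · refine (one_sub_choose_div_choose_le (by omega) (by omega)).trans ?_
    have hd : 1 / ((P : ℝ) - a) ≤ 1 / P * (1 + 2 * ((a : ℝ) / P)) := by
      have e : 1 / (P : ℝ) * (1 + 2 * ((a : ℝ) / P)) = ((P : ℝ) + 2 * a) / (P * P) := by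
        field_simp
      rw [e, div_le_div_iff₀ (by linarith) (by positivity)]
      nlinarith [mul_nonneg (Nat.cast_nonneg (α := ℝ) a) (sub_nonneg.2 ha')]
    calc (a : ℝ) * b / ((P : ℝ) - a) = (a : ℝ) * b * (1 / ((P : ℝ) - a)) := by ring
      _ ≤ (a : ℝ) * b * (1 / P * (1 + 2 * ((a : ℝ) / P))) := by gcongr
      _ = _ := by ring

/-- Two-sided estimate of the mean edge probability relative to `ε = a * K_avg / P`. -/
lemma mean_edge_prob_bounds {ι : Type*} [Fintype ι] (μ : ι → ℝ) (hμpos : ∀ i, 0 < μ i)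
    (hμsum : ∑ i, μ i = 1) {P a : ℕ} (k : ι → ℕ) (hP : 0 < P) (ha : 2 * a ≤ P)
    (hk : ∀ j, 2 * k j ≤ P) (hk1 : ∀ j, 1 ≤ k j) {ε : ℝ}
    (hε : ε = (a : ℝ) * (∑ j, μ j * (k j : ℝ)) / (P : ℝ)) :
    ε * (1 - ε * ∑ j, (μ j)⁻¹) ≤
        ∑ j, μ j * (1 - ((P - a).choose (k j) : ℝ) / (P.choose (k j) : ℝ)) ∧
      ∑ j, μ j * (1 - ((P - a).choose (k j) : ℝ) / (P.choose (k j) : ℝ)) ≤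
        ε * (1 + 2 * ε) := by
  have hεsum : ε = ∑ j, μ j * ((a : ℝ) * k j / P) := by
    rw [hε, Finset.mul_sum, Finset.sum_div]
    exact Finset.sum_congr rfl fun j _ => by ring
  have hterm : ∀ j, 0 ≤ μ j * ((a : ℝ) * k j / P) := fun j =>
    mul_nonneg (hμpos j).le (by positivity)
  have hε0 : 0 ≤ ε := hεsum ▸ Finset.sum_nonneg fun j _ => hterm j
  have hx : ∀ j, (a : ℝ) * k j / P ≤ ε * ∑ i, (μ i)⁻¹ := fun j => by
    have h1 : μ j * ((a : ℝ) * k j / P) ≤ ε := by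
      rw [hεsum]
      exact Finset.single_le_sum (f := fun j => μ j * ((a : ℝ) * k j / P))
        (fun i _ => hterm i) (Finset.mem_univ j)
    have h2 : (μ j)⁻¹ ≤ ∑ i, (μ i)⁻¹ :=
      Finset.single_le_sum (f := fun j => (μ j)⁻¹)
        (fun i _ => (inv_pos.2 (hμpos i)).le) (Finset.mem_univ j)
    calc (a : ℝ) * k j / P ≤ ε * (μ j)⁻¹ := by
          rw [← div_eq_mul_inv, le_div_iff₀ (hμpos j)]; linarith
      _ ≤ _ := mul_le_mul_of_nonneg_left h2 hε0
  have haε : (a : ℝ) / P ≤ ε := by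
    calc (a : ℝ) / P = ∑ j, μ j * ((a : ℝ) / P) := by rw [← Finset.sum_mul, hμsum, one_mul]
      _ ≤ ε := by
        rw [hεsum]
        refine Finset.sum_le_sum fun j _ => mul_le_mul_of_nonneg_left ?_ (hμpos j).le
        have : (1 : ℝ) ≤ k j := by exact_mod_cast hk1 j
        gcongr
        exact le_mul_of_one_le_right (Nat.cast_nonneg a) this
  constructor
  · nth_rewrite 1 [hεsum]
    rw [Finset.sum_mul]
    refine Finset.sum_le_sum fun j _ => ?_
    rw [mul_assoc]
    refine mul_le_mul_of_nonneg_left ?_ (hμpos j).le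
    refine le_trans ?_ (one_sub_choose_div_choose_bounds ha (hk j) hP).1
    have := hx j
    gcongr
  · nth_rewrite 1 [hεsum]
    rw [Finset.sum_mul]
    refine Finset.sum_le_sum fun j _ => ?_
    rw [mul_assoc]
    refine mul_le_mul_of_nonneg_left ?_ (hμpos j).le
    refine (one_sub_choose_div_choose_bounds ha (hk j) hP).2.trans ?_
    gcongr

/-- **Asymptotics of `λ_1`.** Under a scaling `2 ≤ K_{1,n} ≤ ... ≤ K_{r,n} ≤ P_n/2` with a
fixed probability vector `μ`, if `K_{1,n} K_avg,n / P_n = o(1)` where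
`K_avg,n = Σ_j μ_j K_{j,n}`, then `λ_1(n) ~ K_{1,n} K_avg,n / P_n`, where
`λ_1(n) = Σ_j μ_j (1 - C(P_n - K_{1,n}, K_{j,n})/C(P_n, K_{j,n}))`. -/
theorem lambda_one_asymptotic
    (r : ℕ) (hr : 0 < r) (μ : Fin r → ℝ)
    (hμpos : ∀ i, 0 < μ i) (hμsum : ∑ i, μ i = 1)
    (K : ℕ → Fin r → ℕ) (P : ℕ → ℕ)
    (hscal : ∀ n, 2 ≤ K n ⟨0, hr⟩ ∧ Monotone (K n) ∧
      2 * K n ⟨r - 1, Nat.sub_lt hr Nat.one_pos⟩ ≤ P n)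
    (hsmall : Tendsto
      (fun n => (K n ⟨0, hr⟩ : ℝ) * (∑ j, μ j * (K n j : ℝ)) / (P n : ℝ)) atTop (nhds 0)) :
    Tendsto
      (fun n =>
        (∑ j, μ j *
            (1 - ((P n - K n ⟨0, hr⟩).choose (K n j) : ℝ) / ((P n).choose (K n j) : ℝ))) /
          ((K n ⟨0, hr⟩ : ℝ) * (∑ j, μ j * (K n j : ℝ)) / (P n : ℝ)))
      atTop (nhds 1) := by
  have hle : ∀ n j, 2 * K n j ≤ P n := fun n j =>
    (Nat.mul_le_mul_left 2 ((hscal n).2.1 (Fin.le_def.2 (Nat.le_sub_one_of_lt j.2)))).trans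
      (hscal n).2.2
  have hKpos : ∀ n j, 0 < K n j := fun n j =>
    lt_of_lt_of_le (by have := (hscal n).1; omega)
      ((hscal n).2.1 (Fin.le_def.2 (Nat.zero_le _) : ⟨0, hr⟩ ≤ j))
  have hPpos : ∀ n, 0 < P n := fun n => by
    have := hle n ⟨0, hr⟩
    have := hKpos n ⟨0, hr⟩
    omega
  have hbounds := fun n => mean_edge_prob_bounds μ hμpos hμsum (K n) (hPpos n)
    (hle n ⟨0, hr⟩) (hle n) (hKpos n) rfl
  have hpos : ∀ n, 0 < (K n ⟨0, hr⟩ : ℝ) * (∑ j, μ j * (K n j : ℝ)) / (P n : ℝ) := fun n => by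
    have hsum : 0 < ∑ j, μ j * (K n j : ℝ) :=
      Finset.sum_pos (fun j _ => mul_pos (hμpos j) (by exact_mod_cast hKpos n j))
        ⟨⟨0, hr⟩, Finset.mem_univ _⟩
    have hK : (0 : ℝ) < K n ⟨0, hr⟩ := by exact_mod_cast hKpos n _
    have hPr : (0 : ℝ) < P n := by exact_mod_cast hPpos n
    positivity
  refine tendsto_of_tendsto_of_tendsto_of_le_of_le
    (g := fun n => 1 - (K n ⟨0, hr⟩ : ℝ) * (∑ j, μ j * (K n j : ℝ)) / (P n : ℝ) * ∑ j, (μ j)⁻¹)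
    (h := fun n => 1 + 2 * ((K n ⟨0, hr⟩ : ℝ) * (∑ j, μ j * (K n j : ℝ)) / (P n : ℝ)))
    ?_ ?_ ?_ ?_
  · simpa using (hsmall.mul_const (∑ j, (μ j)⁻¹)).const_sub 1
  · simpa using (hsmall.const_mul 2).const_add 1
  · intro n
    exact (le_div_iff₀' (hpos n)).2 (hbounds n).1
  · intro n
    exact (div_le_iff₀' (hpos n)).2 (hbounds n).2
end

section
/- Consider a scaling n ↦ (K_{1,n},...,K_{r,n},P_n) with 2 ≤ K_{1,n} ≤ ... ≤ K_{r,n} ≤ P_n/2 and a fixed probability vector (μ_1,...,μ_r) with all μ_i > 0. Let K_avg,n = Σ_{j=1}^r μ_j K_{j,n} and λ_1(n) = Σ_{j=1}^r μ_j·(1 − C(P_n−K_{1,n}, K_{j,n})/C(P_n, K_{j,n})). Then λ_1(n) = o(1) if and only if K_{1,n}·K_avg,n = o(P_n). -/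
open Filter
open scoped BigOperators Topology

/-- The recursion `q (a + 1) = q a * (1 - b / (P - a))` for the probability
`q a = C(P - a, b) / C(P, b)` of avoiding an `a`-subset, without denominators. -/
lemma sub_mul_choose_sub_succ {P a b : ℕ} (h : a + 1 + b ≤ P) :
    ((P : ℝ) - a) * ((P - (a + 1)).choose b : ℝ)
      = ((P : ℝ) - a - b) * ((P - a).choose b : ℝ) := by
  obtain ⟨d, rfl⟩ := Nat.exists_eq_add_of_le h
  have h1 : a + 1 + b + d - (a + 1) = b + d := by omega
  have h2 : a + 1 + b + d - a = b + d + 1 := by omega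
  have key := Nat.choose_mul_succ_eq (b + d) b
  rw [show b + d + 1 - b = d + 1 by omega] at key
  have key' : ((b + d).choose b : ℝ) * (b + d + 1) = ((b + d + 1).choose b : ℝ) * (d + 1) := by
    exact_mod_cast key
  rw [h1, h2]
  push_cast
  linarith

lemma add_mul_choose_sub_le {P b : ℕ} (a : ℕ) (h : a + b ≤ P) :
    ((P : ℝ) + a * b) * ((P - a).choose b : ℝ) ≤ P * (P.choose b : ℝ) := by
  induction a with
  | zero => simp
  | succ a ih =>
    refine le_trans ?_ (ih (by omega))
    have hrec := sub_mul_choose_sub_succ h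
    have hPR : (a : ℝ) + 1 + b ≤ P := by exact_mod_cast h
    have hb : (0 : ℝ) ≤ b := b.cast_nonneg
    have ha : (0 : ℝ) ≤ a := a.cast_nonneg
    have hpos : (0 : ℝ) < P - a := by linarith
    have hC : (0 : ℝ) ≤ ((P - a).choose b : ℝ) := Nat.cast_nonneg _
    refine le_of_mul_le_mul_left ?_ hpos
    calc ((P : ℝ) - a) * ((P + (a + 1 : ℕ) * b) * ((P - (a + 1)).choose b : ℝ))
        = (P + (a + 1) * b) * (P - a - b) * ((P - a).choose b : ℝ) := by
          push_cast
          linear_combination ((P : ℝ) + (a + 1) * b) * hrec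
      _ ≤ ((P + a * b) * (P - a)) * ((P - a).choose b : ℝ) := by
          refine mul_le_mul_of_nonneg_right ?_ hC
          nlinarith [mul_nonneg ha hb, mul_nonneg hb hb, mul_nonneg (mul_nonneg ha hb) hb]
      _ = (P - a) * ((P + a * b) * ((P - a).choose b : ℝ)) := by ring

lemma sub_mul_choose_le {P b : ℕ} (a : ℕ) (h : a + b ≤ P) (ha2 : 2 * a ≤ P) :
    ((P : ℝ) - 2 * (a * b)) * (P.choose b : ℝ) ≤ P * ((P - a).choose b : ℝ) := by
  induction a with
  | zero => simp
  | succ a ih =>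
    have ih' := ih (by omega) (by omega)
    have hrec := sub_mul_choose_sub_succ h
    have hPR : (a : ℝ) + 1 + b ≤ P := by exact_mod_cast h
    have haR : 2 * ((a : ℝ) + 1) ≤ P := by exact_mod_cast ha2
    have hb : (0 : ℝ) ≤ b := b.cast_nonneg
    have hpos : (0 : ℝ) < P - a := by linarith
    have hC : (0 : ℝ) ≤ ((P - a).choose b : ℝ) := Nat.cast_nonneg _
    have hmono : ((P - a).choose b : ℝ) ≤ (P.choose b : ℝ) := by
      exact_mod_cast Nat.choose_le_choose b (Nat.sub_le P a)
    have hstep : (P : ℝ) * (((P - a).choose b : ℝ) - ((P - (a + 1)).choose b : ℝ))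
        ≤ 2 * b * ((P - a).choose b : ℝ) := by
      refine le_of_mul_le_mul_left ?_ hpos
      calc ((P : ℝ) - a) * (P * (((P - a).choose b : ℝ) - ((P - (a + 1)).choose b : ℝ)))
          = P * (b * ((P - a).choose b : ℝ)) := by linear_combination -(P : ℝ) * hrec
        _ ≤ (2 * (P - a)) * (b * ((P - a).choose b : ℝ)) :=
            mul_le_mul_of_nonneg_right (by linarith) (mul_nonneg hb hC)
        _ = (P - a) * (2 * b * ((P - a).choose b : ℝ)) := by ring
    have hlast := mul_le_mul_of_nonneg_left hmono (mul_nonneg zero_le_two hb)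
    push_cast
    linarith

/-- The intersection probability is at most twice `a * b / P`. -/
lemma one_sub_choose_div_le {P a b : ℕ} (hP : 0 < P) (h : a + b ≤ P) (ha : 2 * a ≤ P) :
    1 - ((P - a).choose b : ℝ) / (P.choose b : ℝ) ≤ 2 * ((a : ℝ) * b / P) := by
  have hP' : (0 : ℝ) < P := by exact_mod_cast hP
  have hC : (0 : ℝ) < (P.choose b : ℝ) := by exact_mod_cast Nat.choose_pos (by omega)
  have key : 1 - 2 * ((a : ℝ) * b / P) ≤ ((P - a).choose b : ℝ) / (P.choose b : ℝ) := by
    rw [le_div_iff₀ hC]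
    refine le_of_mul_le_mul_left ?_ hP'
    calc (P : ℝ) * ((1 - 2 * ((a : ℝ) * b / P)) * (P.choose b : ℝ))
        = (P - 2 * (a * b)) * (P.choose b : ℝ) := by field_simp
      _ ≤ _ := sub_mul_choose_le a h ha
  linarith

/-- `a * b / P` is at most the odds of intersection. -/
lemma mul_div_le_odds {P a b : ℕ} (hP : 0 < P) (h : a + b ≤ P) :
    (a : ℝ) * b / P ≤ (1 - ((P - a).choose b : ℝ) / (P.choose b : ℝ)) /
      (1 - (1 - ((P - a).choose b : ℝ) / (P.choose b : ℝ))) := by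
  have hP' : (0 : ℝ) < P := by exact_mod_cast hP
  have hC : (0 : ℝ) < (P.choose b : ℝ) := by exact_mod_cast Nat.choose_pos (by omega)
  have hD : (0 : ℝ) < ((P - a).choose b : ℝ) := by exact_mod_cast Nat.choose_pos (by omega)
  have key := add_mul_choose_sub_le a h
  rw [sub_sub_cancel, one_sub_div hC.ne', div_div_div_cancel_right₀ hC.ne',
    div_le_div_iff₀ hP' hD]
  linarith

lemma one_sub_choose_div_nonneg (P a b : ℕ) :
    0 ≤ 1 - ((P - a).choose b : ℝ) / (P.choose b : ℝ) :=
  sub_nonneg.2 <| div_le_one_of_le₀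
    (by exact_mod_cast Nat.choose_le_choose b (Nat.sub_le P a)) (Nat.cast_nonneg _)

/-- **Characterization of `λ_1(n) = o(1)`.** Under a scaling
`2 ≤ K_{1,n} ≤ ... ≤ K_{r,n} ≤ P_n/2` with a fixed probability vector `μ`, one has
`λ_1(n) = o(1)` if and only if `K_{1,n} K_avg,n = o(P_n)`, where
`λ_1(n) = Σ_j μ_j (1 - C(P_n - K_{1,n}, K_{j,n})/C(P_n, K_{j,n}))` and
`K_avg,n = Σ_j μ_j K_{j,n}`. -/
theorem lambda_one_small_iff
    (r : ℕ) (hr : 0 < r) (μ : Fin r → ℝ)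
    (hμpos : ∀ i, 0 < μ i) (hμsum : ∑ i, μ i = 1)
    (K : ℕ → Fin r → ℕ) (P : ℕ → ℕ)
    (hscal : ∀ n, 2 ≤ K n ⟨0, hr⟩ ∧ Monotone (K n) ∧
      2 * K n ⟨r - 1, Nat.sub_lt hr Nat.one_pos⟩ ≤ P n) :
    Tendsto
        (fun n => ∑ j, μ j *
          (1 - ((P n - K n ⟨0, hr⟩).choose (K n j) : ℝ) / ((P n).choose (K n j) : ℝ)))
        atTop (nhds 0)
      ↔ Tendsto
          (fun n => (K n ⟨0, hr⟩ : ℝ) * (∑ j, μ j * (K n j : ℝ)) / (P n : ℝ))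
          atTop (nhds 0) := by
  have hbound : ∀ n j, 0 < P n ∧ K n ⟨0, hr⟩ + K n j ≤ P n ∧ 2 * K n ⟨0, hr⟩ ≤ P n := by
    intro n j
    obtain ⟨h2, hmono, hle⟩ := hscal n
    have h0j : K n ⟨0, hr⟩ ≤ K n j := hmono (Fin.mk_le_of_le_val (Nat.zero_le _))
    have hjr : K n j ≤ K n ⟨r - 1, Nat.sub_lt hr Nat.one_pos⟩ :=
      hmono (Fin.le_def.2 (Nat.le_sub_one_of_lt j.isLt))
    omega
  have hsum : ∀ n, (K n ⟨0, hr⟩ : ℝ) * (∑ j, μ j * (K n j : ℝ)) / (P n : ℝ)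
      = ∑ j, μ j * ((K n ⟨0, hr⟩ : ℝ) * K n j / P n) := by
    intro n
    rw [Finset.mul_sum, Finset.sum_div]
    exact Finset.sum_congr rfl fun j _ => by ring
  have hnn : ∀ n j, 0 ≤ μ j *
      (1 - ((P n - K n ⟨0, hr⟩).choose (K n j) : ℝ) / ((P n).choose (K n j) : ℝ)) :=
    fun n j => mul_nonneg (hμpos j).le (one_sub_choose_div_nonneg _ _ _)
  simp only [hsum]
  constructor
  · intro hlim
    have hedge : ∀ j, Tendsto (fun n => 1 - ((P n - K n ⟨0, hr⟩).choose (K n j) : ℝ) /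
        ((P n).choose (K n j) : ℝ)) atTop (𝓝 0) := by
      intro j
      have hterm := squeeze_zero (fun n => hnn n j)
        (fun n => Finset.single_le_sum (fun i _ => hnn n i) (Finset.mem_univ j)) hlim
      simpa [inv_mul_cancel_left₀ (hμpos j).ne'] using hterm.const_mul (μ j)⁻¹
    have hratio : ∀ j, Tendsto (fun n => (K n ⟨0, hr⟩ : ℝ) * K n j / P n) atTop (𝓝 0) := by
      intro j
      have hodds := (hedge j).div ((hedge j).const_sub 1) (by norm_num)
      rw [zero_div] at hodds
      exact squeeze_zero (fun n => by positivity)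
        (fun n => mul_div_le_odds (hbound n j).1 (hbound n j).2.1) hodds
    simpa using tendsto_finsetSum Finset.univ fun j _ => (hratio j).const_mul (μ j)
  · intro hlim
    refine squeeze_zero (fun n => Finset.sum_nonneg fun j _ => hnn n j) (fun n => ?_)
      (by simpa using hlim.const_mul 2)
    rw [Finset.mul_sum]
    refine Finset.sum_le_sum fun j _ => ?_
    obtain ⟨hP, hadd, ha⟩ := hbound n j
    rw [mul_left_comm]
    exact mul_le_mul_of_nonneg_left (one_sub_choose_div_le hP hadd ha) (hμpos j).le
end
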